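/- arXiv:1904.13354 — 2 statements merged into one kernel-verified Lean document; each statement's English description precedes it below -/
import Mathlib

section
/- For every continuous function F : Set ℕ × Set ℕ → Set ℕ, defining graph₂(F) = {⟨m₁, ⟨m₂, k⟩⟩ | k ∈ F(e_{m₁}, e_{m₂})}, one has graph₂(F) · U · V = F(U, V) for all U, V : Set ℕ (application associates to the left). -/
/-- `Set ℕ` identified with `ℕ → Prop`, with the product topology where `Prop`
carries the Sierpiński topology. -/
instance (priority := high) sierpinskiProductTopology : TopologicalSpace (Set ℕ) :=
  inferInstanceAs (TopologicalSpace (ℕ → Prop))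
/-- `eSet n` is the unique finite set of naturals with `n = ∑_{k ∈ eSet n} 2^k`. -/
def eSet (n : ℕ) : Set ℕ := {k | n.testBit k}

/-- The application operation of Scott's graph model. -/
def ap (U V : Set ℕ) : Set ℕ := {n | ∃ m, eSet m ⊆ V ∧ Nat.pair m n ∈ U}

/-- The graph of a binary function `F : Set ℕ × Set ℕ → Set ℕ`. -/
def sGraph₂ (F : Set ℕ × Set ℕ → Set ℕ) : Set ℕ :=
  {x | ∃ m₁ m₂ k : ℕ, x = Nat.pair m₁ (Nat.pair m₂ k) ∧ k ∈ F (eSet m₁, eSet m₂)}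

theorem exists_eSet_eq {s : Set ℕ} (hs : s.Finite) : ∃ m, eSet m = s := by
  induction s, hs using Set.Finite.induction_on with
  | empty => exact ⟨0, by ext; simp [eSet]⟩
  | @insert a s _ _ ih =>
    obtain ⟨m, rfl⟩ := ih
    refine ⟨2 ^ a ||| m, ?_⟩
    ext k
    simp [eSet, Nat.testBit_two_pow, @eq_comm _ a k]

/-- An open set of the Sierpiński space is upward closed under implication. -/
theorem IsOpen.mem_of_imp {s : Set Prop} (hs : IsOpen s) {p q : Prop} (hp : p ∈ s) (h : p → q) :
    q ∈ s := by
  by_cases hq : q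
  · by_cases hp' : p
    · rwa [eq_true hq, ← eq_true hp']
    · rw [eq_false hp'] at hp
      have hmem := hs.mem_nhds hp
      rw [nhds_false, Filter.mem_top] at hmem
      simp [hmem]
  · rwa [eq_false hq, ← eq_false (mt h hq)]

/-- The sets of supersets of finite sets `eSet m ⊆ U` form a neighbourhood basis at `U`. -/
theorem exists_eSet_subset_of_mem_nhds {U : Set ℕ} {O : Set (Set ℕ)} (hO : O ∈ nhds U) :
    ∃ m, eSet m ⊆ U ∧ ∀ W, eSet m ⊆ W → W ∈ O := by
  obtain ⟨O', hO', hopen, hU⟩ := mem_nhds_iff.1 hO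
  obtain ⟨I, u, hu, hsub⟩ := (isOpen_pi_iff (A := fun _ : ℕ => Prop)).1 hopen U hU
  obtain ⟨m, hm⟩ := exists_eSet_eq (I.finite_toSet.inter_of_left U)
  refine ⟨m, hm ▸ Set.inter_subset_right, fun W hW => hO' (hsub fun i hi => ?_)⟩
  exact (hu i hi).1.mem_of_imp (hu i hi).2 fun hUi => hW (hm ▸ ⟨hi, hUi⟩)

theorem isOpen_setOf_mem (k : ℕ) : IsOpen {A : Set ℕ | k ∈ A} :=
  continuous_Prop.1 (continuous_apply (A := fun _ : ℕ => Prop) k)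

theorem graph₂_ap (F : Set ℕ × Set ℕ → Set ℕ) (hF : Continuous F) :
    ∀ U V : Set ℕ, ap (ap (sGraph₂ F) U) V = F (U, V) := by
  have key {k : ℕ} {U V : Set ℕ} (h : k ∈ F (U, V)) : ∃ m₁ m₂, eSet m₁ ⊆ U ∧ eSet m₂ ⊆ V ∧
      ∀ U' V', eSet m₁ ⊆ U' → eSet m₂ ⊆ V' → k ∈ F (U', V') := by
    obtain ⟨O₁, h₁, O₂, h₂, hsub⟩ :=
      mem_nhds_prod_iff.1 (((isOpen_setOf_mem k).preimage hF).mem_nhds h)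
    obtain ⟨m₁, hm₁, H₁⟩ := exists_eSet_subset_of_mem_nhds h₁
    obtain ⟨m₂, hm₂, H₂⟩ := exists_eSet_subset_of_mem_nhds h₂
    exact ⟨m₁, m₂, hm₁, hm₂, fun U' V' hU' hV' => hsub ⟨H₁ U' hU', H₂ V' hV'⟩⟩
  intro U V
  ext k
  constructor
  · rintro ⟨m₂, hm₂, m₁, hm₁, n₁, n₂, j, heq, hj⟩
    simp only [Nat.pair_eq_pair] at heq
    obtain ⟨rfl, rfl, rfl⟩ := heq
    obtain ⟨_, _, ha, hb, H⟩ := key hj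
    exact H U V (ha.trans hm₁) (hb.trans hm₂)
  · intro h
    obtain ⟨m₁, m₂, hm₁, hm₂, H⟩ := key h
    exact ⟨m₂, hm₂, m₁, hm₁, m₁, m₂, k, rfl, H _ _ subset_rfl subset_rfl⟩
end

section
/- There exists an element q : Set ℕ (an 'if-then-else' combinator) such that for all U, V : Set ℕ one has q · {1} · U · V = U and q · {0} · U · V = V. -/
theorem eSet_zero : eSet 0 = ∅ := by
  ext k
  simp [eSet]

theorem eSet_two_pow (n : ℕ) : eSet (2 ^ n) = {n} := by
  ext k
  simp [eSet, Nat.testBit_two_pow, eq_comm]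

/-- The graph of a conditional: the output `n` is read off the second argument if the first one
contains `1`, and off the third argument if the first one contains `0`. -/
def ifThenElse : Set ℕ :=
  {x | ∃ a b c n, x = Nat.pair a (Nat.pair b (Nat.pair c n)) ∧
    (1 ∈ eSet a ∧ n ∈ eSet b ∨ 0 ∈ eSet a ∧ n ∈ eSet c)}

theorem pair_mem_ifThenElse {a b c n : ℕ} :
    Nat.pair a (Nat.pair b (Nat.pair c n)) ∈ ifThenElse ↔
      1 ∈ eSet a ∧ n ∈ eSet b ∨ 0 ∈ eSet a ∧ n ∈ eSet c := by
  constructor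
  · rintro ⟨a', b', c', n', h, hmem⟩
    simp only [Nat.pair_eq_pair] at h
    obtain ⟨rfl, rfl, rfl, rfl⟩ := h
    exact hmem
  · exact fun h => ⟨a, b, c, n, rfl, h⟩

theorem mem_ap_ifThenElse {T U V : Set ℕ} {n : ℕ} :
    n ∈ ap (ap (ap ifThenElse T) U) V ↔ 1 ∈ T ∧ n ∈ U ∨ 0 ∈ T ∧ n ∈ V := by
  constructor
  · rintro ⟨c, hc, b, hb, a, ha, h⟩
    exact (pair_mem_ifThenElse.1 h).imp (fun h => ⟨ha h.1, hb h.2⟩) (fun h => ⟨ha h.1, hc h.2⟩)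
  · rintro (⟨hT, hU⟩ | ⟨hT, hV⟩)
    · refine ⟨0, ?_, 2 ^ n, ?_, 2 ^ 1, ?_, pair_mem_ifThenElse.2 (Or.inl ?_)⟩ <;>
        simp only [eSet_zero, eSet_two_pow, Set.empty_subset, Set.singleton_subset_iff,
          Set.mem_singleton_iff, and_self, hT, hU]
    · refine ⟨2 ^ n, ?_, 0, ?_, 2 ^ 0, ?_, pair_mem_ifThenElse.2 (Or.inr ?_)⟩ <;>
        simp only [eSet_zero, eSet_two_pow, Set.empty_subset, Set.singleton_subset_iff,
          Set.mem_singleton_iff, and_self, hT, hV]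

theorem exists_ifthenelse :
    ∃ q : Set ℕ, ∀ U V : Set ℕ,
      ap (ap (ap q {1}) U) V = U ∧
      ap (ap (ap q {0}) U) V = V := by
  refine ⟨ifThenElse, fun U V => ⟨?_, ?_⟩⟩ <;>
  · ext n
    simp [mem_ap_ifThenElse]
end
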